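/- arXiv:2407.05451 — 2 statements merged into one kernel-verified Lean document; each statement's English description precedes it below -/
import Mathlib

section
/- The 1BB-1F and 2BB-1F formulations have the same optimal value: for any nonnegative unit costs C_pv, C_bt, the infimum over the 1BB-1F feasible set of the cost Σ_t [C_pv·(f_pv_bt(t)+f_pv_ed(t)) + C_bt·f_bt_ed(t)] equals the infimum over the 2BB-1F feasible set of the cost Σ_t [C_pv·f_pv_cp(t) + C_bt·f_bt_cp(t)], where both infima are taken in the extended nonnegative reals (with inf ∅ = ∞). -/
open Finset

/-- Storage level at the end of the previous period (`S0` for the first period). -/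
def sprev (T : ℕ) (S0 : ℝ) (s : Fin T → ℝ) (t : Fin T) : ℝ :=
  if (t : ℕ) = 0 then S0
  else s ⟨(t : ℕ) - 1, Nat.lt_of_le_of_lt (Nat.sub_le _ _) t.isLt⟩

/-- 1BB-1F feasible set. -/
def Feas1BB (T : ℕ) (Pbt Sbt S0 etain etaout : ℝ) (Ppv D : Fin T → ℝ)
    (fbted fpvbt fpved s : Fin T → ℝ) : Prop :=
  ∀ t : Fin T,
    0 ≤ fbted t ∧ 0 ≤ fpvbt t ∧ 0 ≤ fpved t ∧ 0 ≤ s t ∧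
    fbted t + fpved t = D t ∧
    s t = sprev T S0 s t + etain * fpvbt t - (1 / etaout) * fbted t ∧
    fbted t ≤ Pbt ∧ fpvbt t ≤ Pbt ∧ fpvbt t + fpved t ≤ Ppv t ∧ s t ≤ Sbt

/-- 2BB-1F feasible set. -/
def Feas2BB1F (T : ℕ) (Pbt Sbt S0 etain etaout : ℝ) (Ppv D : Fin T → ℝ)
    (fbtcp fpvcp fcpbt fcped s : Fin T → ℝ) : Prop :=
  ∀ t : Fin T,
    0 ≤ fbtcp t ∧ 0 ≤ fpvcp t ∧ 0 ≤ fcpbt t ∧ 0 ≤ fcped t ∧ 0 ≤ s t ∧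
    fbtcp t + fpvcp t = fcpbt t + fcped t ∧
    fcped t = D t ∧
    s t = sprev T S0 s t + etain * fcpbt t - (1 / etaout) * fbtcp t ∧
    fbtcp t ≤ Pbt ∧ fcpbt t ≤ Pbt ∧ fpvcp t ≤ Ppv t ∧
    fcped t ≤ Pbt + Ppv t ∧ s t ≤ Sbt

/-- Storage trajectory starting at `S0` with increments `u`, capped at `Sbt`. -/
def cappedStorage (T : ℕ) (Sbt S0 : ℝ) (u : Fin T → ℝ) : ℕ → ℝ
  | 0 => S0
  | n + 1 => if h : n < T then min Sbt (cappedStorage T Sbt S0 u n + u ⟨n, h⟩)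
      else cappedStorage T Sbt S0 u n

lemma cappedStorage_succ (T : ℕ) (Sbt S0 : ℝ) (u : Fin T → ℝ) (t : Fin T) :
    cappedStorage T Sbt S0 u (t + 1) = min Sbt (cappedStorage T Sbt S0 u t + u t) := by
  simp [cappedStorage]

lemma cappedStorage_le {T : ℕ} {Sbt S0 : ℝ} (h0 : S0 ≤ Sbt) (u : Fin T → ℝ) (n : ℕ) :
    cappedStorage T Sbt S0 u n ≤ Sbt := by
  induction n with
  | zero => exact h0
  | succ n ih =>
    rw [cappedStorage]
    split_ifs
    · exact min_le_left _ _
    · exact ih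

lemma sprev_shift (T : ℕ) (r : ℕ → ℝ) (t : Fin T) :
    sprev T (r 0) (fun i => r (i + 1)) t = r t := by
  rcases t with ⟨_ | n, h⟩ <;> simp [sprev]

/-- The capped trajectory dominates every capacity-respecting trajectory with smaller increments. -/
lemma sprev_le_cappedStorage {T : ℕ} {Sbt S0 : ℝ} {u s : Fin T → ℝ}
    (hs : ∀ t, s t ≤ Sbt) (hu : ∀ t, s t ≤ sprev T S0 s t + u t) (t : Fin T) :
    sprev T S0 s t ≤ cappedStorage T Sbt S0 u t := by
  rcases t with ⟨n, h⟩
  induction n with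
  | zero => simp [sprev, cappedStorage]
  | succ n ih =>
    have hn : n < T := by omega
    have h1 := ih hn
    have h2 := hu ⟨n, hn⟩
    have h3 : sprev T S0 s ⟨n + 1, h⟩ = s ⟨n, hn⟩ := by simp [sprev]
    rw [h3]
    simp only [cappedStorage, hn, dite_true]
    exact le_min (hs _) (by linarith)

lemma Feas1BB.feas2BB1F {T : ℕ} {Pbt Sbt S0 etain etaout : ℝ} {Ppv D : Fin T → ℝ}
    {fbted fpvbt fpved s : Fin T → ℝ} (hD : ∀ t, 0 ≤ D t)
    (h : Feas1BB T Pbt Sbt S0 etain etaout Ppv D fbted fpvbt fpved s) :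
    Feas2BB1F T Pbt Sbt S0 etain etaout Ppv D fbted (fun t => fpvbt t + fpved t) fpvbt D s := by
  intro t
  obtain ⟨h1, h2, h3, h4, h5, h6, h7, h8, h9, h10⟩ := h t
  have := hD t
  refine ⟨h1, ?_, h2, this, h4, ?_, rfl, h6, h7, h8, h9, ?_, h10⟩ <;> linarith

/-- Removing simultaneous charging and discharging, and curtailing surplus charging, turns a
2BB-1F solution into a 1BB-1F solution that uses no more of either source. -/
lemma Feas2BB1F.exists_feas1BB {T : ℕ} {Pbt Sbt S0 etain etaout : ℝ} {Ppv D : Fin T → ℝ}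
    {fbtcp fpvcp fcpbt fcped s : Fin T → ℝ} (hS0' : S0 ≤ Sbt)
    (hin : 0 < etain) (hin1 : etain ≤ 1) (hout : 0 < etaout) (hout1 : etaout ≤ 1)
    (h : Feas2BB1F T Pbt Sbt S0 etain etaout Ppv D fbtcp fpvcp fcpbt fcped s) :
    ∃ fbted fpvbt fpved s' : Fin T → ℝ,
      Feas1BB T Pbt Sbt S0 etain etaout Ppv D fbted fpvbt fpved s' ∧
      (∀ t, fpvbt t + fpved t ≤ fpvcp t) ∧ ∀ t, fbted t ≤ fbtcp t := by
  have hk : 1 ≤ 1 / etaout := by rw [le_div_iff₀ hout]; linarith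
  set k := 1 / etaout
  let b : Fin T → ℝ := fun t => min (fbtcp t) (D t)
  let c : Fin T → ℝ := fun t => fcpbt t - (fbtcp t - b t)
  let u : Fin T → ℝ := fun t => etain * c t - k * b t
  let r := cappedStorage T Sbt S0 u
  have hb1 : ∀ t, b t ≤ fbtcp t := fun t => min_le_left _ _
  have hb2 : ∀ t, b t ≤ D t := fun t => min_le_right _ _
  have hb0 : ∀ t, 0 ≤ b t := fun t => by
    obtain ⟨h1, -, -, h4, -, -, h7, -⟩ := h t
    exact le_min h1 (h7 ▸ h4)
  have hc0 : ∀ t, 0 ≤ c t := fun t => by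
    obtain ⟨-, h2, h3, -, -, h6, h7, -⟩ := h t
    rcases min_choice (fbtcp t) (D t) with e | e <;> simp only [c, b, e] <;> linarith
  have hu : ∀ t, s t ≤ sprev T S0 s t + u t := fun t => by
    obtain ⟨-, -, -, -, -, -, -, h8, -⟩ := h t
    have : 0 ≤ (k - etain) * (fbtcp t - b t) :=
      mul_nonneg (by linarith) (by linarith [hb1 t])
    simp only [u, c]
    linarith
  have hsS : ∀ t, s t ≤ Sbt := fun t => (h t).2.2.2.2.2.2.2.2.2.2.2.2
  have hr : ∀ t : Fin T, r (t + 1) = min Sbt (r t + u t) := cappedStorage_succ T Sbt S0 u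
  refine ⟨b, fun t => (r (t + 1) - r t + k * b t) / etain, fun t => D t - b t,
    fun t => r (t + 1), ?_⟩
  have hv0 : ∀ t : Fin T, 0 ≤ (r (t + 1) - r t + k * b t) / etain := fun t => by
    refine div_nonneg ?_ hin.le
    have h1 : r t ≤ Sbt := cappedStorage_le hS0' u t
    have h2 : 0 ≤ k * b t := mul_nonneg (by linarith) (hb0 t)
    have h3 : 0 ≤ etain * c t := mul_nonneg hin.le (hc0 t)
    have h4 : r t - k * b t ≤ r (t + 1) := by
      rw [hr]
      exact le_min (by linarith) (by simp only [u]; linarith)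
    linarith
  have hvc : ∀ t : Fin T, (r (t + 1) - r t + k * b t) / etain ≤ c t := fun t => by
    rw [div_le_iff₀ hin]
    have h1 : r (t + 1) ≤ r t + u t := hr t ▸ min_le_right _ _
    simp only [u] at h1
    linarith
  have hpv : ∀ t : Fin T,
      (r (t + 1) - r t + k * b t) / etain + (D t - b t) ≤ fpvcp t := fun t => by
    obtain ⟨-, -, -, -, -, h6, h7, -⟩ := h t
    have := hvc t
    simp only [c] at this
    linarith
  refine ⟨fun t => ?_, hpv, hb1⟩
  obtain ⟨-, -, -, -, h5, -, -, -, h9, h10, h11, -, -⟩ := h t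
  refine ⟨hb0 t, hv0 t, by linarith [hb2 t], ?_, by ring, ?_, (hb1 t).trans h9, ?_,
    (hpv t).trans h11, cappedStorage_le hS0' u _⟩
  · have h1 : sprev T S0 s t ≤ r t := sprev_le_cappedStorage hsS hu t
    have h2 : s t ≤ r (t + 1) := by
      rw [hr]
      exact le_min (hsS t) (by linarith [hu t])
    linarith
  · have h1 : sprev T S0 (fun i => r (i + 1)) t = r t := sprev_shift T r t
    rw [h1, mul_div_cancel₀ _ hin.ne']
    ring
  · have h1 := hvc t
    have h2 := hb1 t
    simp only [c] at h1
    linarith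

/-- the 1BB-1F and 2BB-1F formulations have the same optimal value. -/
theorem stmt6 (T : ℕ) (hT : 1 ≤ T) (Pbt Sbt S0 etain etaout : ℝ)
    (hPbt : 0 ≤ Pbt) (hSbt : 0 ≤ Sbt) (hS0 : 0 ≤ S0) (hS0' : S0 ≤ Sbt)
    (hin : 0 < etain) (hin1 : etain ≤ 1) (hout : 0 < etaout) (hout1 : etaout ≤ 1)
    (Ppv D : Fin T → ℝ) (hPpv : ∀ t, 0 ≤ Ppv t) (hD : ∀ t, 0 ≤ D t)
    (Cpv Cbt : ℝ) (hCpv : 0 ≤ Cpv) (hCbt : 0 ≤ Cbt) :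
    sInf {c : ENNReal | ∃ fbted fpvbt fpved s : Fin T → ℝ,
        Feas1BB T Pbt Sbt S0 etain etaout Ppv D fbted fpvbt fpved s ∧
        c = ENNReal.ofReal (∑ t, (Cpv * (fpvbt t + fpved t) + Cbt * fbted t))}
      = sInf {c : ENNReal | ∃ fbtcp fpvcp fcpbt fcped s : Fin T → ℝ,
        Feas2BB1F T Pbt Sbt S0 etain etaout Ppv D fbtcp fpvcp fcpbt fcped s ∧
        c = ENNReal.ofReal (∑ t, (Cpv * fpvcp t + Cbt * fbtcp t))} := by
  apply le_antisymm
  · refine le_sInf ?_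
    rintro _ ⟨fbtcp, fpvcp, fcpbt, fcped, s, h, rfl⟩
    obtain ⟨b, v, e, s', h', hpv, hb⟩ := h.exists_feas1BB hS0' hin hin1 hout hout1
    refine sInf_le_of_le ⟨b, v, e, s', h', rfl⟩ (ENNReal.ofReal_le_ofReal ?_)
    exact sum_le_sum fun t _ => add_le_add (mul_le_mul_of_nonneg_left (hpv t) hCpv)
      (mul_le_mul_of_nonneg_left (hb t) hCbt)
  · refine le_sInf ?_
    rintro _ ⟨b, v, e, s, h, rfl⟩
    exact sInf_le ⟨b, fun t => v t + e t, v, D, s, h.feas2BB1F hD, rfl⟩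
end

section
/- Eliminating the lossless connection-line building block preserves the model: there is a correspondence between the 3BB-4F feasible set and the 2BB-2F feasible set such that (i) for every 3BB-4F feasible point, the point of the 2BB-2F model obtained by setting f_cp_ed(t) := f_cp_cl(t) and f_ed_cp(t) := 0 while keeping f_bt_cp, f_pv_cp, f_cp_bt and s unchanged is 2BB-2F feasible, and (ii) for every 2BB-2F feasible point, setting f_cp_cl(t) := f_cp_ed(t), f_cl_ed(t) := f_cp_ed(t), f_ed_cl(t) := 0, f_cl_cp(t) := 0 while keeping the other variables unchanged yields a 3BB-4F feasible point; in both directions the PV output f_pv_cp, the battery charge f_cp_bt, the battery discharge f_bt_cp, and the storage trajectory s are preserved, so for any nonnegative unit costs C_pv, C_bt (zero cost on connection-line flows) the infima of the cost Σ_t [C_pv·f_pv_cp(t) + C_bt·f_bt_cp(t)] over the two feasible sets coincide. -/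
open Finset

/-- 2BB-2F feasible set (grid-to-battery charging forbidden). -/
def Feas2BB2F (T : ℕ) (Pbt Sbt S0 etain etaout : ℝ) (Ppv D : Fin T → ℝ)
    (fbtcp fpvcp fcpbt fcped fedcp s : Fin T → ℝ) : Prop :=
  ∀ t : Fin T,
    0 ≤ fbtcp t ∧ 0 ≤ fpvcp t ∧ 0 ≤ fcpbt t ∧ 0 ≤ fcped t ∧ 0 ≤ fedcp t ∧ 0 ≤ s t ∧
    fbtcp t + fpvcp t + fedcp t = fcpbt t + fcped t ∧
    fcped t = D t + fedcp t ∧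
    s t = sprev T S0 s t + etain * fcpbt t - (1 / etaout) * fbtcp t ∧
    fbtcp t ≤ Pbt ∧ fcpbt t ≤ Pbt ∧ fpvcp t ≤ Ppv t ∧ fedcp t = 0 ∧
    fcped t ≤ Pbt + Ppv t ∧ s t ≤ Sbt

/-- 3BB-4F feasible set (grid-to-battery charging forbidden via `fclcp = 0`). -/
def Feas3BB4F (T : ℕ) (Pbt Sbt S0 etain etaout : ℝ) (Ppv D : Fin T → ℝ)
    (fbtcp fpvcp fclcp fcpbt fcpcl fcled fedcl s : Fin T → ℝ) : Prop :=
  ∀ t : Fin T,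
    0 ≤ fbtcp t ∧ 0 ≤ fpvcp t ∧ 0 ≤ fclcp t ∧ 0 ≤ fcpbt t ∧ 0 ≤ fcpcl t ∧
    0 ≤ fcled t ∧ 0 ≤ fedcl t ∧ 0 ≤ s t ∧
    fbtcp t + fpvcp t + fclcp t = fcpbt t + fcpcl t ∧
    fcled t = D t + fedcl t ∧
    fcpcl t + fedcl t = fclcp t + fcled t ∧
    s t = sprev T S0 s t + etain * fcpbt t - (1 / etaout) * fbtcp t ∧
    fbtcp t ≤ Pbt ∧ fcpbt t ≤ Pbt ∧ fpvcp t ≤ Ppv t ∧ fclcp t = 0 ∧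
    fcpcl t ≤ Pbt + Ppv t ∧ fcled t ≤ Pbt + Ppv t ∧ fedcl t ≤ Pbt + Ppv t ∧ s t ≤ Sbt

/-- Every 3BB-4F feasible point projects to a 2BB-2F feasible point. -/
theorem Feas3BB4F.toFeas2BB2F {T : ℕ} {Pbt Sbt S0 etain etaout : ℝ} {Ppv D : Fin T → ℝ}
    {fbtcp fpvcp fclcp fcpbt fcpcl fcled fedcl s : Fin T → ℝ}
    (h : Feas3BB4F T Pbt Sbt S0 etain etaout Ppv D
      fbtcp fpvcp fclcp fcpbt fcpcl fcled fedcl s) :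
    Feas2BB2F T Pbt Sbt S0 etain etaout Ppv D fbtcp fpvcp fcpbt fcpcl (fun _ => 0) s := by
  intro t
  obtain ⟨hbt, hpv, -, hcb, hcc, -, -, hs, hcp, hed, hcl, hst, hbt', hcb', hpv', hclcp, hcc', -, -,
    hs'⟩ := h t
  exact ⟨hbt, hpv, hcb, hcc, le_rfl, hs, by linarith, by linarith, hst, hbt', hcb', hpv', rfl,
    hcc', hs'⟩

/-- Every 2BB-2F feasible point lifts to a 3BB-4F feasible point. -/
theorem Feas2BB2F.toFeas3BB4F {T : ℕ} {Pbt Sbt S0 etain etaout : ℝ} {Ppv D : Fin T → ℝ}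
    {fbtcp fpvcp fcpbt fcped fedcp s : Fin T → ℝ}
    (h : Feas2BB2F T Pbt Sbt S0 etain etaout Ppv D fbtcp fpvcp fcpbt fcped fedcp s) :
    Feas3BB4F T Pbt Sbt S0 etain etaout Ppv D
      fbtcp fpvcp (fun _ => 0) fcpbt fcped fcped (fun _ => 0) s := by
  intro t
  obtain ⟨hbt, hpv, hcb, hce, -, hs, hcp, hed, hst, hbt', hcb', hpv', hedcp, hce', hs'⟩ := h t
  exact ⟨hbt, hpv, le_rfl, hcb, hce, hce, le_rfl, hs, by linarith, by linarith, by ring, hst,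
    hbt', hcb', hpv', rfl, hce', hce', hce.trans hce', hs'⟩

/-- eliminating the lossless connection-line building block preserves
the model: correspondence between the 3BB-4F and 2BB-2F feasible sets, preserving
PV output, battery charge/discharge and storage, hence equal cost infima. -/
theorem stmt11 (T : ℕ) (hT : 1 ≤ T) (Pbt Sbt S0 etain etaout : ℝ)
    (hPbt : 0 ≤ Pbt) (hSbt : 0 ≤ Sbt) (hS0 : 0 ≤ S0) (hS0' : S0 ≤ Sbt)
    (hin : 0 < etain) (hin1 : etain ≤ 1) (hout : 0 < etaout) (hout1 : etaout ≤ 1)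
    (Ppv D : Fin T → ℝ) (hPpv : ∀ t, 0 ≤ Ppv t) (hD : ∀ t, 0 ≤ D t) :
    (∀ fbtcp fpvcp fclcp fcpbt fcpcl fcled fedcl s : Fin T → ℝ,
      Feas3BB4F T Pbt Sbt S0 etain etaout Ppv D fbtcp fpvcp fclcp fcpbt fcpcl fcled fedcl s →
      Feas2BB2F T Pbt Sbt S0 etain etaout Ppv D fbtcp fpvcp fcpbt fcpcl (fun _ => 0) s) ∧
    (∀ fbtcp fpvcp fcpbt fcped fedcp s : Fin T → ℝ,
      Feas2BB2F T Pbt Sbt S0 etain etaout Ppv D fbtcp fpvcp fcpbt fcped fedcp s →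
      Feas3BB4F T Pbt Sbt S0 etain etaout Ppv D fbtcp fpvcp (fun _ => 0) fcpbt fcped fcped (fun _ => 0) s) ∧
    ∀ Cpv Cbt : ℝ, 0 ≤ Cpv → 0 ≤ Cbt →
      sInf {c : ENNReal | ∃ fbtcp fpvcp fclcp fcpbt fcpcl fcled fedcl s : Fin T → ℝ,
        Feas3BB4F T Pbt Sbt S0 etain etaout Ppv D fbtcp fpvcp fclcp fcpbt fcpcl fcled fedcl s ∧
        c = ENNReal.ofReal (∑ t, (Cpv * fpvcp t + Cbt * fbtcp t))}
        = sInf {c : ENNReal | ∃ fbtcp fpvcp fcpbt fcped fedcp s : Fin T → ℝ,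
        Feas2BB2F T Pbt Sbt S0 etain etaout Ppv D fbtcp fpvcp fcpbt fcped fedcp s ∧
        c = ENNReal.ofReal (∑ t, (Cpv * fpvcp t + Cbt * fbtcp t))} := by
  refine ⟨fun _ _ _ _ _ _ _ _ h => h.toFeas2BB2F, fun _ _ _ _ _ _ h => h.toFeas3BB4F, ?_⟩
  intro Cpv Cbt _ _
  congr 1
  ext c
  constructor
  · rintro ⟨_, _, _, _, _, _, _, _, h, rfl⟩
    exact ⟨_, _, _, _, _, _, h.toFeas2BB2F, rfl⟩
  · rintro ⟨_, _, _, _, _, _, h, rfl⟩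
    exact ⟨_, _, _, _, _, _, _, _, h.toFeas3BB4F, rfl⟩
end
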